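/- For every z ∈ ℂ and every τ in the complex upper half-plane ℍ (so that 2τ, τ/2 and (τ+1)/2 also lie in ℍ), Θ(z, 2τ)² · η(2τ)⁸ = −(1/4) · [ Θ(z/2, τ/2)² · η(τ/2)⁸ + e^{2πi/3} · Θ(z/2, (τ+1)/2)² · η((τ+1)/2)⁸ ]. (This is the identity underlying the coefficient relation c_{2n} + 2^{g−4} d_n = 0 between the Fourier coefficients of the quasimodular forms f̃_g and f_g in the paper's evaluation of the Hodge integrals of Enriques surfaces.) -/

import Mathlib

open Complex

/-- The Dedekind eta function `η(τ) = e^{πiτ/12}·∏_{n≥1}(1−qⁿ)` with `q = e^{2πiτ}`. -/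
noncomputable def dedekindEta (τ : ℂ) : ℂ :=
  Complex.exp (Real.pi * Complex.I * τ / 12) *
    ∏' n : ℕ, (1 - Complex.exp (2 * Real.pi * Complex.I * τ) ^ (n + 1))

/-- The normalized Jacobi theta function
`Θ(z,τ) = (e^{z/2} − e^{−z/2})·∏_{m≥1}(1−e^z qᵐ)(1−e^{−z} qᵐ)/(1−qᵐ)²` with `q = e^{2πiτ}`. -/
noncomputable def jacobiThetaN (z τ : ℂ) : ℂ :=
  (Complex.exp (z / 2) - Complex.exp (-z / 2)) *
    ∏' m : ℕ,
      ((1 - Complex.exp z * Complex.exp (2 * Real.pi * Complex.I * τ) ^ (m + 1)) *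
          (1 - Complex.exp (-z) * Complex.exp (2 * Real.pi * Complex.I * τ) ^ (m + 1)) /
        (1 - Complex.exp (2 * Real.pi * Complex.I * τ) ^ (m + 1)) ^ 2)

open Filter Topology

lemma norm_sq_lt_one {r : ℂ} (hr : ‖r‖ < 1) : ‖r ^ 2‖ < 1 := by
  rw [norm_pow]
  exact pow_lt_one₀ (norm_nonneg r) hr two_ne_zero

/-- `(a; q)_∞ = ∏_{n ≥ 0} (1 - a qⁿ)`. -/
noncomputable def qPochInf (a q : ℂ) : ℂ := ∏' n : ℕ, (1 - a * q ^ n)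

lemma summable_qPochInf (a : ℂ) {q : ℂ} (hq : ‖q‖ < 1) :
    Summable fun n : ℕ ↦ ‖-(a * q ^ n)‖ := by
  simpa using (summable_geometric_of_lt_one (norm_nonneg q) hq).mul_left ‖a‖

lemma multipliable_qPochInf (a : ℂ) {q : ℂ} (hq : ‖q‖ < 1) :
    Multipliable fun n : ℕ ↦ 1 - a * q ^ n := by
  simpa only [sub_eq_add_neg] using multipliable_one_add_of_summable (summable_qPochInf a hq)

lemma qPochInf_eq_mul (a : ℂ) {q : ℂ} (hq : ‖q‖ < 1) :
    qPochInf a q = (1 - a) * qPochInf (a * q) q := by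
  have h : Multipliable fun n : ℕ ↦ 1 - a * q ^ (n + 1) := by
    simpa only [pow_succ', ← mul_assoc] using multipliable_qPochInf (a * q) hq
  have h' := tprod_eq_zero_mul' (f := fun n : ℕ ↦ 1 - a * q ^ n) h
  simpa only [qPochInf, pow_zero, mul_one, pow_succ', ← mul_assoc] using h'

lemma qPochInf_even_mul_odd (a : ℂ) {q : ℂ} (hq : ‖q‖ < 1) :
    qPochInf a (q ^ 2) * qPochInf (a * q) (q ^ 2) = qPochInf a q := by
  have hq2 : ‖q ^ 2‖ < 1 := norm_sq_lt_one hq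
  rw [qPochInf, qPochInf, qPochInf, ← tprod_even_mul_odd (f := fun n : ℕ ↦ 1 - a * q ^ n)]
  · congr 2 with n <;> ring
  · exact (multipliable_qPochInf a hq2).congr fun n ↦ by ring
  · exact (multipliable_qPochInf (a * q) hq2).congr fun n ↦ by ring

lemma qPochInf_mul_neg (a : ℂ) {q : ℂ} (hq : ‖q‖ < 1) :
    qPochInf a q * qPochInf (-a) q = qPochInf (a ^ 2) (q ^ 2) := by
  rw [qPochInf, qPochInf, qPochInf,
    ← (multipliable_qPochInf a hq).tprod_mul (multipliable_qPochInf (-a) hq)]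
  congr 1 with n
  ring

lemma one_sub_pow_succ_ne_zero {q : ℂ} (hq : ‖q‖ < 1) (n : ℕ) : 1 - q * q ^ n ≠ 0 := by
  intro h
  have h1 : q ^ (n + 1) = 1 := by rw [pow_succ']; linear_combination -h
  have h2 : ‖q ^ (n + 1)‖ < 1 := by
    rw [norm_pow]; exact pow_lt_one₀ (norm_nonneg q) hq n.succ_ne_zero
  simp [h1] at h2

lemma qPochInf_self_ne_zero {q : ℂ} (hq : ‖q‖ < 1) : qPochInf q q ≠ 0 := by
  have h := tprod_one_add_ne_zero_of_summable (f := fun n : ℕ ↦ -(q * q ^ n))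
    (fun n ↦ by simpa [sub_eq_add_neg] using one_sub_pow_succ_ne_zero hq n)
    (summable_qPochInf q hq)
  simpa [qPochInf, sub_eq_add_neg] using h

/-- `1 / (q; q)_k`, extended by zero to negative `k`. -/
noncomputable def invQFactorial (q : ℂ) (k : ℤ) : ℂ :=
  if k < 0 then 0 else (∏ m ∈ Finset.range k.toNat, (1 - q * q ^ m))⁻¹

lemma invQFactorial_eq {q : ℂ} (hq0 : q ≠ 0) (hq : ‖q‖ < 1) (k : ℤ) :
    invQFactorial q k = (1 - q ^ (k + 1)) * invQFactorial q (k + 1) := by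
  rcases lt_trichotomy k (-1) with h | rfl | h
  · simp [invQFactorial, show k < 0 by lia, show k + 1 < 0 by lia]
  · simp [invQFactorial]
  · lift k to ℕ using by lia
    have h1 : ((k : ℤ) + 1).toNat = k + 1 := by lia
    rw [invQFactorial, invQFactorial, if_neg (by lia), if_neg (by lia), h1, Int.toNat_natCast,
      Finset.prod_range_succ, mul_inv, mul_comm (_⁻¹) (_⁻¹), ← mul_assoc]
    have := one_sub_pow_succ_ne_zero hq k
    rw [zpow_add_one₀ hq0, zpow_natCast, mul_comm (q ^ k) q, mul_inv_cancel₀ this, one_mul]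

lemma tendsto_qFactorial {q : ℂ} (hq : ‖q‖ < 1) :
    Tendsto (fun n ↦ ∏ m ∈ Finset.range n, (1 - q * q ^ m)) atTop (𝓝 (qPochInf q q)) :=
  (multipliable_qPochInf q hq).hasProd.tendsto_prod_nat

lemma tendsto_invQFactorial {q : ℂ} (hq : ‖q‖ < 1) :
    Tendsto (invQFactorial q) atTop (𝓝 (qPochInf q q)⁻¹) := by
  have h : Tendsto Int.toNat atTop atTop :=
    tendsto_atTop.2 fun n ↦ (eventually_ge_atTop (n : ℤ)).mono fun k hk ↦ by lia
  refine (((tendsto_qFactorial hq).inv₀ (qPochInf_self_ne_zero hq)).comp h).congr' ?_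
  filter_upwards [eventually_ge_atTop (0 : ℤ)] with k hk
  simp [invQFactorial, not_lt.2 hk]

lemma exists_norm_invQFactorial_le {q : ℂ} (hq : ‖q‖ < 1) :
    ∃ C, ∀ k, ‖invQFactorial q k‖ ≤ C := by
  obtain ⟨C, hC⟩ := ((tendsto_qFactorial hq).inv₀
    (qPochInf_self_ne_zero hq)).norm.bddAbove_range
  refine ⟨C, fun k ↦ ?_⟩
  have h := fun n ↦ hC (Set.mem_range_self n)
  unfold invQFactorial
  split_ifs
  · simpa using (norm_nonneg _).trans (h 0)
  · exact h _

/-- The bilateral theta series `∑_{n ∈ ℤ} r^{n²} xⁿ`. -/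
noncomputable def thetaSeries (x r : ℂ) : ℂ := ∑' n : ℤ, r ^ (n ^ 2) * x ^ n

lemma summable_thetaSeries {x r : ℂ} (hx : x ≠ 0) (hr0 : r ≠ 0) (hr : ‖r‖ < 1) :
    Summable fun n : ℤ ↦ r ^ (n ^ 2) * x ^ n := by
  have hpi : (Real.pi : ℂ) ≠ 0 := by exact_mod_cast Real.pi_ne_zero
  have him : 0 < (Complex.log r / (Real.pi * Complex.I)).im := by
    have h : Complex.log r / (Real.pi * Complex.I)
        = ((Real.pi⁻¹ : ℝ) : ℂ) * (-(Complex.I * Complex.log r)) := by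
      push_cast; field_simp; simp
    rw [h, Complex.im_ofReal_mul]
    simpa [Complex.log_re] using mul_neg_of_pos_of_neg (inv_pos.2 Real.pi_pos)
      (Real.log_neg (norm_pos_iff.2 hr0) hr)
  refine ((summable_jacobiTheta₂_term_iff (Complex.log x / (2 * Real.pi * Complex.I))
    (Complex.log r / (Real.pi * Complex.I))).2 him).congr fun n ↦ ?_
  rw [jacobiTheta₂_term, Complex.exp_add, mul_comm]
  congr 1
  · conv_rhs => rw [← Complex.exp_log hr0, ← Complex.exp_int_mul]
    congr 1; push_cast; field_simp
  · conv_rhs => rw [← Complex.exp_log hx, ← Complex.exp_int_mul]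
    congr 1; field_simp

/-- A finite form of the Jacobi triple product. -/
lemma hasSum_finite_tripleProduct {x r : ℂ} (hx : x ≠ 0) (hr0 : r ≠ 0) (hr : ‖r‖ < 1) (n : ℕ) :
    HasSum (fun k : ℤ ↦ (∏ m ∈ Finset.range (2 * n), (1 - r ^ 2 * (r ^ 2) ^ m)) *
        invQFactorial (r ^ 2) (n + k) * invQFactorial (r ^ 2) (n - k) * (r ^ (k ^ 2) * x ^ k))
      (∏ m ∈ Finset.range n,
        (1 - -(x * r) * (r ^ 2) ^ m) * (1 - -(x⁻¹ * r) * (r ^ 2) ^ m)) := by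
  have hq : ‖r ^ 2‖ < 1 := norm_sq_lt_one hr
  have hq0 : r ^ 2 ≠ 0 := pow_ne_zero 2 hr0
  induction n with
  | zero =>
    convert hasSum_single (0 : ℤ) fun k hk ↦ ?_ using 1
    · simp [invQFactorial]
    · rcases lt_or_gt_of_ne hk with h | h <;> simp [invQFactorial, h]
  | succ n ih =>
    rw [Finset.prod_range_succ]
    have h1 := ((Equiv.addRight (1 : ℤ)).hasSum_iff.2 ih).mul_left (x⁻¹ * r ^ (2 * n + 1))
    have h2 := ((Equiv.subRight (1 : ℤ)).hasSum_iff.2 ih).mul_left (x * r ^ (2 * n + 1))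
    have h3 := ih.mul_left (1 + r ^ (4 * n + 2))
    have hprod (P : ℂ) :
        P * ((1 - -(x * r) * (r ^ 2) ^ n) * (1 - -(x⁻¹ * r) * (r ^ 2) ^ n)) =
          x⁻¹ * r ^ (2 * n + 1) * P + x * r ^ (2 * n + 1) * P + (1 + r ^ (4 * n + 2)) * P := by
      field_simp
      ring
    rw [hprod]
    refine ((h1.add h2).add h3).congr_fun fun k ↦ ?_
    simp only [Function.comp_apply, Equiv.coe_addRight, Equiv.subRight_apply]
    rw [show 2 * (n + 1) = 2 * n + 1 + 1 by ring, Finset.prod_range_succ, Finset.prod_range_succ]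
    generalize ∏ m ∈ Finset.range (2 * n), (1 - r ^ 2 * (r ^ 2) ^ m) = P
    rw [invQFactorial_eq hq0 hq (n + (k - 1)), invQFactorial_eq hq0 hq (n - (k + 1)),
      show (n : ℤ) + (k - 1) + 1 = n + k by ring, show (n : ℤ) - (k + 1) + 1 = n - k by ring,
      show (n : ℤ) - (k - 1) = n - k + 1 by ring, show (n : ℤ) + (k + 1) = n + k + 1 by ring,
      invQFactorial_eq hq0 hq (n + k), invQFactorial_eq hq0 hq (n - k),
      show ((n + 1 : ℕ) : ℤ) + k = n + k + 1 by push_cast; ring,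
      show ((n + 1 : ℕ) : ℤ) - k = n - k + 1 by push_cast; ring]
    generalize invQFactorial (r ^ 2) (n + k + 1) = a
    generalize invQFactorial (r ^ 2) (n - k + 1) = b
    rw [show (k + 1) ^ 2 = k ^ 2 + k + k + 1 by ring,
      show (k - 1) ^ 2 = k ^ 2 - k - k + 1 by ring]
    simp only [zpow_add₀ hr0, zpow_sub₀ hr0, zpow_add₀ hx, zpow_sub₀ hx, zpow_one,
      zpow_add₀ hq0, zpow_sub₀ hq0, zpow_natCast,
      show (r ^ 2 : ℂ) ^ k = r ^ k * r ^ k by rw [← mul_zpow, sq]]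
    have hk := zpow_ne_zero k hr0
    have hxk := zpow_ne_zero k hx
    generalize r ^ k = K at *
    generalize r ^ (k ^ 2) = K2 at *
    generalize x ^ k = X at *
    field_simp
    ring

/-- The Jacobi triple product identity. -/
theorem thetaSeries_eq_qPochInf {x r : ℂ} (hx : x ≠ 0) (hr0 : r ≠ 0) (hr : ‖r‖ < 1) :
    thetaSeries x r =
      qPochInf (r ^ 2) (r ^ 2) * (qPochInf (-(x * r)) (r ^ 2) * qPochInf (-(x⁻¹ * r)) (r ^ 2)) := by
  have hq : ‖r ^ 2‖ < 1 := norm_sq_lt_one hr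
  have hE := qPochInf_self_ne_zero hq
  obtain ⟨C, hC⟩ := exists_norm_invQFactorial_le hq
  obtain ⟨D, hD⟩ := (tendsto_qFactorial hq).norm.bddAbove_range
  have hD' := fun n ↦ hD (Set.mem_range_self n)
  have hlim := tendsto_tsum_of_dominated_convergence (𝓕 := atTop)
    (f := fun (n : ℕ) (k : ℤ) ↦ (∏ m ∈ Finset.range (2 * n), (1 - r ^ 2 * (r ^ 2) ^ m)) *
        invQFactorial (r ^ 2) (n + k) * invQFactorial (r ^ 2) (n - k) * (r ^ (k ^ 2) * x ^ k))
    (g := fun k ↦ qPochInf (r ^ 2) (r ^ 2) * (qPochInf (r ^ 2) (r ^ 2))⁻¹ *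
      (qPochInf (r ^ 2) (r ^ 2))⁻¹ * (r ^ (k ^ 2) * x ^ k))
    (bound := fun k ↦ D * C * C * ‖r ^ (k ^ 2) * x ^ k‖)
    ((summable_thetaSeries hx hr0 hr).norm.mul_left _)
    (fun k ↦ by
      refine Tendsto.mul_const _ (Tendsto.mul (Tendsto.mul ?_ ?_) ?_)
      · exact (tendsto_qFactorial hq).comp (tendsto_id.const_mul_atTop' two_pos)
      · exact (tendsto_invQFactorial hq).comp
          (tendsto_atTop_add_const_right _ k tendsto_natCast_atTop_atTop)
      · exact (tendsto_invQFactorial hq).comp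
          (tendsto_atTop_add_const_right _ (-k) tendsto_natCast_atTop_atTop))
    (Eventually.of_forall fun n k ↦ by
      have hD0 : 0 ≤ D := (norm_nonneg _).trans (hD' 0)
      have hC0 : 0 ≤ C := (norm_nonneg _).trans (hC 0)
      rw [norm_mul, norm_mul, norm_mul]
      gcongr
      · exact hD' (2 * n)
      · exact hC _
      · exact hC _)
  simp_rw [(hasSum_finite_tripleProduct hx hr0 hr _).tsum_eq, tsum_mul_left,
    mul_inv_cancel₀ hE, one_mul] at hlim
  have hprod := ((multipliable_qPochInf (-(x * r)) hq).mul
    (multipliable_qPochInf (-(x⁻¹ * r)) hq)).hasProd.tendsto_prod_nat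
  have h := tendsto_nhds_unique hlim hprod
  rw [(multipliable_qPochInf _ hq).tprod_mul (multipliable_qPochInf _ hq)] at h
  rw [qPochInf, qPochInf, qPochInf, ← h, ← qPochInf, ← thetaSeries, mul_inv_cancel_left₀ hE]

lemma thetaSeries_neg_right (x r : ℂ) : thetaSeries x (-r) = thetaSeries (-x) r := by
  unfold thetaSeries
  congr 1 with n
  rcases Int.even_or_odd n with h | h
  · rw [h.neg_zpow, (h.pow_of_ne_zero two_ne_zero).neg_zpow]
  · rw [h.neg_zpow, h.pow.neg_zpow]
    ring

lemma thetaSeries_mul_sq_left {x r : ℂ} (hx : x ≠ 0) (hr : r ≠ 0) :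
    r * x * thetaSeries (x * r ^ 2) r = thetaSeries x r := by
  unfold thetaSeries
  rw [← (Equiv.addRight (1 : ℤ)).tsum_eq (fun n : ℤ ↦ r ^ (n ^ 2) * x ^ n), ← tsum_mul_left]
  congr 1 with n
  rw [Equiv.coe_addRight, show (n + 1) ^ 2 = n ^ 2 + n + n + 1 by ring, mul_zpow,
    show (r ^ 2 : ℂ) ^ n = r ^ n * r ^ n by rw [← mul_zpow, sq]]
  simp only [zpow_add₀ hr, zpow_add₀ hx, zpow_one]
  ring

/-- Pairs of integers, split according to the parity of their sum. -/
def intPairEquiv : (ℤ × ℤ) ⊕ (ℤ × ℤ) ≃ ℤ × ℤ where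
  toFun := Sum.elim (fun c ↦ (c.1 + c.2, c.1 - c.2)) (fun c ↦ (c.1 + c.2 + 1, c.1 - c.2))
  invFun c := if (c.1 + c.2) % 2 = 0 then .inl ((c.1 + c.2) / 2, (c.1 - c.2) / 2)
    else .inr ((c.1 + c.2) / 2, (c.1 - c.2) / 2)
  left_inv := by
    rintro (⟨a, b⟩ | ⟨a, b⟩)
    · have h : (a + b + (a - b)) % 2 = 0 := by lia
      exact (if_pos h).trans (congrArg Sum.inl (Prod.ext (by dsimp; lia) (by dsimp; lia)))
    · have h : ¬ (a + b + 1 + (a - b)) % 2 = 0 := by lia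
      exact (if_neg h).trans (congrArg Sum.inr (Prod.ext (by dsimp; lia) (by dsimp; lia)))
  right_inv := by
    rintro ⟨m, n⟩
    dsimp only
    split_ifs with h <;> simp only [Sum.elim_inl, Sum.elim_inr, Prod.mk.injEq] <;> lia

/-- The addition formula for products of two theta series. -/
theorem thetaSeries_mul_thetaSeries {x y r : ℂ} (hx : x ≠ 0) (hy : y ≠ 0) (hr0 : r ≠ 0)
    (hr : ‖r‖ < 1) :
    thetaSeries x r * thetaSeries y r =
      thetaSeries (x * y) (r ^ 2) * thetaSeries (x / y) (r ^ 2) +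
        r * x * (thetaSeries (x * y * r ^ 2) (r ^ 2) * thetaSeries (x / y * r ^ 2) (r ^ 2)) := by
  have hq : ‖r ^ 2‖ < 1 := norm_sq_lt_one hr
  have hq0 : r ^ 2 ≠ 0 := pow_ne_zero 2 hr0
  have hxy : x * y ≠ 0 := mul_ne_zero hx hy
  have hdiv : x / y ≠ 0 := div_ne_zero hx hy
  have hs {u s : ℂ} (hu : u ≠ 0) (hs0 : s ≠ 0) (hs : ‖s‖ < 1) :=
    (summable_thetaSeries hu hs0 hs).norm
  have h1 := summable_mul_of_summable_norm (hs hxy hq0 hq) (hs hdiv hq0 hq)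
  have h2 := summable_mul_of_summable_norm (hs (mul_ne_zero hxy hq0) hq0 hq)
    (hs (mul_ne_zero hdiv hq0) hq0 hq)
  unfold thetaSeries
  rw [tsum_mul_tsum_of_summable_norm (hs hx hr0 hr) (hs hy hr0 hr),
    tsum_mul_tsum_of_summable_norm (hs hxy hq0 hq) (hs hdiv hq0 hq),
    tsum_mul_tsum_of_summable_norm (hs (mul_ne_zero hxy hq0) hq0 hq)
      (hs (mul_ne_zero hdiv hq0) hq0 hq), ← intPairEquiv.tsum_eq]
  have h2' := h2.hasSum.mul_left (r * x)
  have hsq (k : ℤ) : (r ^ 2) ^ k = r ^ k * r ^ k := by rw [← mul_zpow, sq]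
  refine (HasSum.sum (h1.hasSum.congr_fun ?_) (h2'.congr_fun ?_)).tsum_eq
  · rintro ⟨a, b⟩
    simp only [intPairEquiv, Equiv.coe_fn_mk, Function.comp_apply, Sum.elim_inl]
    rw [show (a + b) ^ 2 = a ^ 2 + b ^ 2 + a * b + a * b by ring,
      show (a - b) ^ 2 = a ^ 2 + b ^ 2 - a * b - a * b by ring]
    simp only [zpow_add₀ hr0, zpow_sub₀ hr0, zpow_add₀ hx, zpow_sub₀ hy, hsq, mul_zpow, div_zpow]
    have h := zpow_ne_zero (a * b) hr0
    have h' := zpow_ne_zero b hy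
    field_simp
  · rintro ⟨a, b⟩
    simp only [intPairEquiv, Equiv.coe_fn_mk, Function.comp_apply, Sum.elim_inr]
    rw [show (a + b + 1) ^ 2 = a ^ 2 + b ^ 2 + a * b + a * b + a + a + b + b + 1 by ring,
      show (a - b) ^ 2 = a ^ 2 + b ^ 2 - a * b - a * b by ring]
    simp only [zpow_add₀ hr0, zpow_sub₀ hr0, zpow_add₀ hx, zpow_sub₀ hy, hsq, mul_zpow, div_zpow,
      zpow_one]
    have h := zpow_ne_zero (a * b) hr0
    have h' := zpow_ne_zero b hy
    field_simp

lemma thetaSeries_neg_one_mul {p : ℂ} (hp0 : p ≠ 0) (hp : ‖p‖ < 1) :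
    thetaSeries (-1) p * qPochInf (p ^ 2) (p ^ 2) = qPochInf p p ^ 2 := by
  rw [thetaSeries_eq_qPochInf (by norm_num) hp0 hp, ← qPochInf_even_mul_odd p hp, ← sq p,
    show -(-1 * p) = p by ring, show -((-1)⁻¹ * p) = p by norm_num]
  ring

lemma thetaSeries_self_mul {p : ℂ} (hp0 : p ≠ 0) (hp : ‖p‖ < 1) :
    thetaSeries p p * qPochInf (p ^ 2) (p ^ 2) = 2 * qPochInf (p ^ 4) (p ^ 4) ^ 2 := by
  have hq : ‖p ^ 2‖ < 1 := norm_sq_lt_one hp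
  have h1 := qPochInf_mul_neg (p ^ 2) hq
  have h2 := qPochInf_eq_mul (-1) hq
  rw [show (p ^ 2) ^ 2 = p ^ 4 by ring] at h1
  rw [thetaSeries_eq_qPochInf hp0 hp0 hp, inv_mul_cancel₀ hp0, h2, ← h1, ← sq p, neg_one_mul]
  ring

/-- The product `(x - 2 + 1/x) · ∏ (1 - x pᵐ)² (1 - pᵐ/x)² (1 - pᵐ)⁴` over `m ≥ 1`. -/
noncomputable def thetaEtaProd (x p : ℂ) : ℂ :=
  ((1 - x) * qPochInf (x * p) p * qPochInf (x⁻¹ * p) p * qPochInf p p ^ 2) ^ 2 / x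

lemma thetaEtaProd_eq {x r : ℂ} (hx : x ≠ 0) (hr0 : r ≠ 0) (hr : ‖r‖ < 1) :
    thetaEtaProd x (r ^ 2) =
      (thetaSeries (-x / r) r * qPochInf (r ^ 2) (r ^ 2)) ^ 2 / x := by
  have hq : ‖r ^ 2‖ < 1 := norm_sq_lt_one hr
  rw [thetaSeries_eq_qPochInf (div_ne_zero (neg_ne_zero.2 hx) hr0) hr0 hr,
    show -(-x / r * r) = x by field_simp, show -((-x / r)⁻¹ * r) = x⁻¹ * r ^ 2 by field_simp,
    qPochInf_eq_mul x hq, thetaEtaProd]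
  ring

lemma thetaSeries_neg_div_sq {x r : ℂ} (hx : x ≠ 0) (hr0 : r ≠ 0) (hr : ‖r‖ < 1) :
    thetaSeries (-x / r) r ^ 2 =
      thetaSeries (x ^ 2 / r ^ 2) (r ^ 2) * thetaSeries 1 (r ^ 2) -
        x * (thetaSeries (x ^ 2) (r ^ 2) * thetaSeries (r ^ 2) (r ^ 2)) := by
  have h : -x / r ≠ 0 := div_ne_zero (neg_ne_zero.2 hx) hr0
  rw [sq (thetaSeries _ _), thetaSeries_mul_thetaSeries h h hr0 hr, div_self h, one_mul,
    show -x / r * (-x / r) = x ^ 2 / r ^ 2 by ring, div_mul_cancel₀ _ (pow_ne_zero 2 hr0),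
    show r * (-x / r) = -x by field_simp]
  ring

lemma thetaSeries_mul_neg_one_sub {y p : ℂ} (hy : y ≠ 0) (hp0 : p ≠ 0) (hp : ‖p‖ < 1) :
    thetaSeries y p * thetaSeries (-1) p - thetaSeries (-y) p * thetaSeries 1 p =
      2 * p * thetaSeries (-y / p ^ 2) (p ^ 2) ^ 2 / y := by
  have hp2 := pow_ne_zero 2 hp0
  have hs := thetaSeries_mul_sq_left (div_ne_zero (neg_ne_zero.2 hy) hp2) hp2
  rw [show p ^ 2 * (-y / p ^ 2) = -y by field_simp,
    show -y / p ^ 2 * (p ^ 2) ^ 2 = -y * p ^ 2 by field_simp] at hs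
  rw [thetaSeries_mul_thetaSeries hy (neg_ne_zero.2 one_ne_zero) hp0 hp,
    thetaSeries_mul_thetaSeries (neg_ne_zero.2 hy) one_ne_zero hp0 hp, ← hs]
  simp only [mul_neg, mul_one, div_neg, div_one]
  field_simp
  ring

/-- The odd part of `thetaEtaProd x p` as a function of `p = r²`. -/
theorem thetaEtaProd_sub_neg {x r : ℂ} (hx : x ≠ 0) (hr0 : r ≠ 0) (hr : ‖r‖ < 1) :
    thetaEtaProd x (r ^ 2) - thetaEtaProd x (-r ^ 2) =
      -4 * r ^ 2 * thetaEtaProd (x ^ 2) ((r ^ 2) ^ 4) := by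
  have hI : (Complex.I * r) ^ 2 = -r ^ 2 := by rw [mul_pow, Complex.I_sq]; ring
  have hI0 : Complex.I * r ≠ 0 := mul_ne_zero Complex.I_ne_zero hr0
  have hIr : ‖Complex.I * r‖ < 1 := by simpa using hr
  have t1 := thetaEtaProd_eq hx hr0 hr
  have t2 := thetaEtaProd_eq hx hI0 hIr
  have e1 := thetaSeries_neg_div_sq hx hr0 hr
  have e2 := thetaSeries_neg_div_sq hx hI0 hIr
  have hp0 : r ^ 2 ≠ 0 := pow_ne_zero 2 hr0
  have hp : ‖r ^ 2‖ < 1 := norm_sq_lt_one hr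
  rw [mul_pow, e1] at t1
  rw [mul_pow (thetaSeries _ _), e2, hI] at t2
  rw [t1, t2]
  generalize r ^ 2 = p at hp0 hp
  have hp2 : ‖p ^ 2‖ < 1 := norm_sq_lt_one hp
  have e3 := thetaSeries_mul_neg_one_sub (pow_ne_zero 2 hx) hp0 hp
  have e4 := thetaSeries_neg_one_mul hp0 hp
  have e5 := thetaSeries_neg_one_mul (neg_ne_zero.2 hp0) (by rwa [norm_neg])
  have e6 := thetaSeries_self_mul hp0 hp
  have t3 := thetaEtaProd_eq (pow_ne_zero 2 hx) (pow_ne_zero 2 hp0) hp2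
  rw [show (p ^ 2) ^ 2 = p ^ 4 by ring] at t3
  rw [t3, ← e4, ← e5]
  simp only [thetaSeries_neg_right, neg_neg, neg_sq, div_neg]
  have hxx : x * x⁻¹ = 1 := mul_inv_cancel₀ hx
  linear_combination (-(thetaSeries p p * qPochInf (p ^ 2) (p ^ 2))) * e3 -
    2 * p * thetaSeries (-x ^ 2 / p ^ 2) (p ^ 2) ^ 2 / x ^ 2 * e6 -
    thetaSeries p p * qPochInf (p ^ 2) (p ^ 2) * (thetaSeries (x ^ 2) p * thetaSeries (-1) p -
      thetaSeries (-x ^ 2) p * thetaSeries 1 p) * hxx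

lemma tprod_theta_eq {q : ℂ} (hq : ‖q‖ < 1) (a b : ℂ) :
    ∏' m : ℕ, ((1 - a * q ^ (m + 1)) * (1 - b * q ^ (m + 1)) / (1 - q ^ (m + 1)) ^ 2) =
      qPochInf (a * q) q * qPochInf (b * q) q / qPochInf q q ^ 2 := by
  have hE := qPochInf_self_ne_zero hq
  have hC := (multipliable_qPochInf q hq).hasProd
  have h := ((multipliable_qPochInf (a * q) hq).hasProd.mul
    (multipliable_qPochInf (b * q) hq).hasProd).div₀ (hC.mul hC) (mul_ne_zero hE hE)
  rw [sq, qPochInf, qPochInf, qPochInf, ← h.tprod_eq]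
  exact tprod_congr fun m ↦ by simp only [pow_succ', mul_assoc, pow_zero, mul_one]

lemma jacobiThetaN_sq_mul_dedekindEta_pow (z : ℂ) {τ : ℂ} (hτ : 0 < τ.im) :
    jacobiThetaN z τ ^ 2 * dedekindEta τ ^ 8 = Complex.exp (2 * Real.pi * Complex.I * τ / 3) *
      thetaEtaProd (Complex.exp z) (Complex.exp (2 * Real.pi * Complex.I * τ)) := by
  have hq : ‖Complex.exp (2 * Real.pi * Complex.I * τ)‖ < 1 := by
    rw [Complex.norm_exp, Real.exp_lt_one_iff]
    simpa using mul_pos Real.two_pi_pos hτ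
  have hE := qPochInf_self_ne_zero hq
  have hη : Complex.exp (Real.pi * Complex.I * τ / 12) ^ 8 =
      Complex.exp (2 * Real.pi * Complex.I * τ / 3) := by
    rw [← Complex.exp_nat_mul]; congr 1; push_cast; ring
  have hz : Complex.exp z = Complex.exp (z / 2) ^ 2 := by
    rw [← Complex.exp_nat_mul]; congr 1; push_cast; ring
  have hdiff : (Complex.exp (z / 2) - Complex.exp (-z / 2)) ^ 2 =
      (1 - Complex.exp z) ^ 2 / Complex.exp z := by
    have h := Complex.exp_ne_zero (z / 2)
    rw [hz, neg_div, Complex.exp_neg]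
    field_simp
    ring
  rw [jacobiThetaN, dedekindEta, tprod_theta_eq hq, mul_pow, mul_pow, hη, hdiff, thetaEtaProd,
    Complex.exp_neg]
  have hE' : ∏' n : ℕ, (1 - Complex.exp (2 * Real.pi * Complex.I * τ) ^ (n + 1)) =
      qPochInf (Complex.exp (2 * Real.pi * Complex.I * τ))
        (Complex.exp (2 * Real.pi * Complex.I * τ)) :=
    tprod_congr fun n ↦ by rw [pow_succ']
  rw [hE']
  have hx := Complex.exp_ne_zero z
  field_simp

/-- `Θ(z,2τ)²·η(2τ)⁸ = −(1/4)·[Θ(z/2,τ/2)²·η(τ/2)⁸ + e^{2πi/3}·Θ(z/2,(τ+1)/2)²·η((τ+1)/2)⁸]`. -/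
theorem theta_eta_halving_identity (z τ : ℂ) (hτ : 0 < τ.im) :
    jacobiThetaN z (2 * τ) ^ 2 * dedekindEta (2 * τ) ^ 8 =
      -(1 / 4) *
        (jacobiThetaN (z / 2) (τ / 2) ^ 2 * dedekindEta (τ / 2) ^ 8 +
          Complex.exp (2 * Real.pi * Complex.I / 3) *
            jacobiThetaN (z / 2) ((τ + 1) / 2) ^ 2 * dedekindEta ((τ + 1) / 2) ^ 8) := by
  have h2 : 0 < (2 * τ).im := by simpa using hτ
  have h3 : 0 < (τ / 2).im := by simpa using hτ
  have h4 : 0 < ((τ + 1) / 2).im := by simpa using hτ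
  set r := Complex.exp (Real.pi * Complex.I * τ / 2) with hr_def
  have hr : ‖r‖ < 1 := by
    rw [hr_def, Complex.norm_exp, Real.exp_lt_one_iff]
    simpa [neg_div] using mul_pos Real.pi_pos hτ
  have hsq : r ^ 2 = Complex.exp (Real.pi * Complex.I * τ) := by
    rw [hr_def, ← Complex.exp_nat_mul]; congr 1; push_cast; ring
  have q1 : Complex.exp (2 * Real.pi * Complex.I * (τ / 2)) = r ^ 2 := by
    rw [hsq]; congr 1; ring
  have q2 : Complex.exp (2 * Real.pi * Complex.I * ((τ + 1) / 2)) = -r ^ 2 := by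
    rw [hsq, show 2 * Real.pi * Complex.I * ((τ + 1) / 2) =
      Real.pi * Complex.I * τ + Real.pi * Complex.I by ring, Complex.exp_add, Complex.exp_pi_mul_I]
    ring
  have q3 : Complex.exp (2 * Real.pi * Complex.I * (2 * τ)) = (r ^ 2) ^ 4 := by
    rw [hsq, ← Complex.exp_nat_mul]; congr 1; push_cast; ring
  have p2 : Complex.exp (2 * Real.pi * Complex.I / 3) *
      Complex.exp (2 * Real.pi * Complex.I * ((τ + 1) / 2) / 3) =
      -Complex.exp (2 * Real.pi * Complex.I * (τ / 2) / 3) := by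
    rw [← Complex.exp_add, show 2 * Real.pi * Complex.I / 3 +
      2 * Real.pi * Complex.I * ((τ + 1) / 2) / 3 =
      2 * Real.pi * Complex.I * (τ / 2) / 3 + Real.pi * Complex.I by ring, Complex.exp_add,
      Complex.exp_pi_mul_I]
    ring
  have p3 : Complex.exp (2 * Real.pi * Complex.I * (2 * τ) / 3) =
      Complex.exp (2 * Real.pi * Complex.I * (τ / 2) / 3) * r ^ 2 := by
    rw [hsq, ← Complex.exp_add]; congr 1; ring
  have hx : Complex.exp z = Complex.exp (z / 2) ^ 2 := by
    rw [← Complex.exp_nat_mul]; congr 1; push_cast; ring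
  have key := thetaEtaProd_sub_neg (Complex.exp_ne_zero (z / 2)) (Complex.exp_ne_zero _) hr
  rw [← hr_def] at key
  rw [mul_assoc (Complex.exp (2 * Real.pi * Complex.I / 3)),
    jacobiThetaN_sq_mul_dedekindEta_pow z h2, jacobiThetaN_sq_mul_dedekindEta_pow _ h3,
    jacobiThetaN_sq_mul_dedekindEta_pow _ h4,
    ← mul_assoc (Complex.exp (2 * Real.pi * Complex.I / 3)), p2, q1, q2, q3, p3, hx]
  linear_combination (1 / 4) * Complex.exp (2 * Real.pi * Complex.I * (τ / 2) / 3) * key
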